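/- Let (𝒜, p) be a perfect n𝒫-poset and let {σ_α : 𝒜_α → Subd(𝒜)} be a family of subdivisions over n𝒫 that is locally confluent, facially compatible, and terminating. Then for every x ∈ 𝒜 there is a unique terminal finite set S(x) ⊆ 𝒜 with {x} →* S(x); moreover Σ(x) := ⟨S(x)⟩ (the downward closure of S(x) in 𝒜) is an 𝒜-subdivision with n-support p(x), and the map x ↦ Σ(x) is a canonical subdivision over n𝒫. -/

import Mathlib

open Pointwise

/-- A point of `ℝ^d` with integer coordinates. -/
def IsLatticePt {d : ℕ} (x : Fin d → ℝ) : Prop := ∀ i, ∃ z : ℤ, x i = (z : ℝ)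

/-- The subgroup `ℤ^d` of integral points of `ℝ^d`. -/
def intLattice (d : ℕ) : AddSubgroup (Fin d → ℝ) where
  carrier := {x | IsLatticePt x}
  zero_mem' := fun i => ⟨0, by simp⟩
  add_mem' := by
    rintro a b ha hb i
    obtain ⟨z, hz⟩ := ha i
    obtain ⟨w, hw⟩ := hb i
    exact ⟨z + w, by simp [hz, hw]⟩
  neg_mem' := by
    rintro a ha i
    obtain ⟨z, hz⟩ := ha i
    exact ⟨-z, by simp [hz]⟩

/-- A polytope: the convex hull of a nonempty finite set of points. -/
def IsPolytope {d : ℕ} (P : Set (Fin d → ℝ)) : Prop :=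
  ∃ V : Finset (Fin d → ℝ), V.Nonempty ∧ P = convexHull ℝ (V : Set (Fin d → ℝ))

/-- An integral polytope: the convex hull of a nonempty finite set of integral points. -/
def IsIntegralPolytope {d : ℕ} (P : Set (Fin d → ℝ)) : Prop :=
  ∃ V : Finset (Fin d → ℝ), V.Nonempty ∧ (∀ v ∈ V, IsLatticePt v) ∧
    P = convexHull ℝ (V : Set (Fin d → ℝ))

/-- A simplex: the convex hull of a nonempty affinely independent finite set. -/
def IsSimplex {d : ℕ} (P : Set (Fin d → ℝ)) : Prop :=
  ∃ V : Finset (Fin d → ℝ), V.Nonempty ∧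
    AffineIndependent ℝ (Subtype.val : ↥(V : Set (Fin d → ℝ)) → (Fin d → ℝ)) ∧
    P = convexHull ℝ (V : Set (Fin d → ℝ))

/-- An integral simplex. -/
def IsIntegralSimplex {d : ℕ} (P : Set (Fin d → ℝ)) : Prop :=
  ∃ V : Finset (Fin d → ℝ), V.Nonempty ∧ (∀ v ∈ V, IsLatticePt v) ∧
    AffineIndependent ℝ (Subtype.val : ↥(V : Set (Fin d → ℝ)) → (Fin d → ℝ)) ∧
    P = convexHull ℝ (V : Set (Fin d → ℝ))

/-- The set of differences of vertices (= extreme points) of a polytope. -/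
def vertexDiffs {d : ℕ} (P : Set (Fin d → ℝ)) : Set (Fin d → ℝ) :=
  {w | ∃ u ∈ P.extremePoints ℝ, ∃ v ∈ P.extremePoints ℝ, w = u - v}

/-- `L(P)`: the subgroup of `ℤ^d` generated by differences of vertices of `P`. -/
def latL {d : ℕ} (P : Set (Fin d → ℝ)) : AddSubgroup (Fin d → ℝ) :=
  AddSubgroup.closure (vertexDiffs P)

/-- `N(P)`: the intersection of the real span of `L(P)` with `ℤ^d`. -/
def latN {d : ℕ} (P : Set (Fin d → ℝ)) : AddSubgroup (Fin d → ℝ) :=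
  (Submodule.span ℝ (vertexDiffs P)).toAddSubgroup ⊓ intLattice d

/-- The (normalized) index of an integral polytope: the group index `[N(P) : L(P)]`. -/
noncomputable def polyIndex {d : ℕ} (P : Set (Fin d → ℝ)) : ℕ :=
  ((latL P).addSubgroupOf (latN P)).index

/-- A unimodular simplex: an integral simplex of index 1. -/
def IsUnimodularSimplex {d : ℕ} (P : Set (Fin d → ℝ)) : Prop :=
  IsIntegralSimplex P ∧ polyIndex P = 1

/-- `F` is a face of `P`: the (nonempty) set of maximizers on `P` of a linear functional. -/
def IsFaceOf {d : ℕ} (F P : Set (Fin d → ℝ)) : Prop :=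
  F.Nonempty ∧ ∃ φ : (Fin d → ℝ) →ₗ[ℝ] ℝ, F = {x ∈ P | ∀ y ∈ P, φ y ≤ φ x}

/-- A triangulation of `Q`: a finite, face-closed collection of simplices with union `Q`,
any two of which meet in a (possibly empty) common face. -/
def IsTriangulation {d : ℕ} (T : Set (Set (Fin d → ℝ))) (Q : Set (Fin d → ℝ)) : Prop :=
  T.Finite ∧ (∀ S ∈ T, IsSimplex S) ∧ ⋃₀ T = Q ∧
    (∀ S ∈ T, ∀ F, IsFaceOf F S → F ∈ T) ∧
    ∀ S₁ ∈ T, ∀ S₂ ∈ T, S₁ ∩ S₂ = ∅ ∨ (IsFaceOf (S₁ ∩ S₂) S₁ ∧ IsFaceOf (S₁ ∩ S₂) S₂)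

/-- A unimodular triangulation: all of its simplices are unimodular. -/
def IsUnimodularTriangulation {d : ℕ} (T : Set (Set (Fin d → ℝ))) (Q : Set (Fin d → ℝ)) : Prop :=
  IsTriangulation T Q ∧ ∀ S ∈ T, IsUnimodularSimplex S

/-- A polytopal complex. -/
def IsPolytopalComplex {d : ℕ} (X : Set (Set (Fin d → ℝ))) : Prop :=
  X.Finite ∧ (∀ P ∈ X, IsPolytope P) ∧
    (∀ P ∈ X, ∀ F, IsFaceOf F P → F ∈ X) ∧
    ∀ P ∈ X, ∀ Q ∈ X, P ≠ Q → intrinsicInterior ℝ P ∩ intrinsicInterior ℝ Q = ∅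

/-- The order on `n𝒫`: each `F i` is the (nonempty) face of `P i` with respect to one single
linear functional. -/
def NPFace {d n : ℕ} (F P : Fin n → Set (Fin d → ℝ)) : Prop :=
  ∃ φ : (Fin d → ℝ) →ₗ[ℝ] ℝ, ∀ i, (F i).Nonempty ∧ F i = {x ∈ P i | ∀ y ∈ P i, φ y ≤ φ x}

/-- The Minkowski sum of an `n`-tuple of subsets of `ℝ^d`. -/
def minkSum {d n : ℕ} (P : Fin n → Set (Fin d → ℝ)) : Set (Fin d → ℝ) :=
  ∑ i, P i

/-- `X` is an `𝒜`-complex for the `n𝒫`-poset `(𝒜, p)`: the Minkowski sums of the tuples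
`p x`, `x ∈ X`, form a polytopal complex, and `x ↦ Σ(p x)` is a poset isomorphism from `X`
onto this complex (ordered by the face relation). -/
def IsAComplex {d n : ℕ} {𝒜 : Type*} [PartialOrder 𝒜]
    (p : 𝒜 → Fin n → Set (Fin d → ℝ)) (X : Set 𝒜) : Prop :=
  IsPolytopalComplex ((fun x => minkSum (p x)) '' X) ∧
  Set.InjOn (fun x => minkSum (p x)) X ∧
  ∀ x ∈ X, ∀ y ∈ X, (x ≤ y ↔ IsFaceOf (minkSum (p x)) (minkSum (p y)))

/-- The support of an `𝒜`-complex. -/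
def suppOf {d n : ℕ} {𝒜 : Type*} (p : 𝒜 → Fin n → Set (Fin d → ℝ)) (X : Set 𝒜) :
    Set (Fin d → ℝ) :=
  ⋃ x ∈ X, minkSum (p x)

/-- The `n`-support of an `𝒜`-complex. -/
def nsuppOf {d n : ℕ} {𝒜 : Type*} (p : 𝒜 → Fin n → Set (Fin d → ℝ)) (X : Set 𝒜) :
    Fin n → Set (Fin d → ℝ) :=
  fun k => ⋃ x ∈ X, p x k

/-- An `𝒜`-subdivision: an `𝒜`-complex whose support is a polytope. -/
def IsASubdivision {d n : ℕ} {𝒜 : Type*} [PartialOrder 𝒜]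
    (p : 𝒜 → Fin n → Set (Fin d → ℝ)) (X : Set 𝒜) : Prop :=
  IsAComplex p X ∧ IsPolytope (suppOf p X)

/-- The order on `Subd(𝒜)`: `X'` is a subcomplex of `X` whose support is a face of the
support of `X`. -/
def SubdLE {d n : ℕ} {𝒜 : Type*} [PartialOrder 𝒜]
    (p : 𝒜 → Fin n → Set (Fin d → ℝ)) (X' X : Set 𝒜) : Prop :=
  X' ⊆ X ∧ IsAComplex p X' ∧ IsFaceOf (suppOf p X') (suppOf p X)

/-- The set of maximal elements of a subset of a poset. -/
def MaxElems {𝒜 : Type*} [PartialOrder 𝒜] (S : Set 𝒜) : Set 𝒜 :=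
  {x ∈ S | ∀ y ∈ S, x ≤ y → x = y}

/-- A `σ_α`-move at `x`: replace `x ∈ X` by the maximal elements of `σ_α x`. -/
def MoveTo {𝒜 : Type*} [PartialOrder 𝒜] {ι : Type*} (A : ι → Set 𝒜) (σ : ι → 𝒜 → Set 𝒜)
    (X Y : Set 𝒜) : Prop :=
  ∃ α x, x ∈ X ∧ x ∈ A α ∧ Y = (X \ {x}) ∪ MaxElems (σ α x)

/-- `X →* Y`: `Y` is obtained from `X` by a finite (possibly empty) sequence of moves. -/
def MovesTo {𝒜 : Type*} [PartialOrder 𝒜] {ι : Type*} (A : ι → Set 𝒜) (σ : ι → 𝒜 → Set 𝒜)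
    (X Y : Set 𝒜) : Prop :=
  Relation.ReflTransGen (MoveTo A σ) X Y

/-- Two sets are joinable if some set is reachable from both. -/
def Joinable {𝒜 : Type*} [PartialOrder 𝒜] {ι : Type*} (A : ι → Set 𝒜) (σ : ι → 𝒜 → Set 𝒜)
    (X Y : Set 𝒜) : Prop :=
  ∃ Z, MovesTo A σ X Z ∧ MovesTo A σ Y Z

/-- A set is terminal if no move changes it. -/
def TerminalSet {𝒜 : Type*} [PartialOrder 𝒜] {ι : Type*} (A : ι → Set 𝒜) (σ : ι → 𝒜 → Set 𝒜)
    (X : Set 𝒜) : Prop :=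
  ∀ Y, MoveTo A σ X Y → Y = X

theorem exists_supporting_functional {d : ℕ} {F : Set (Fin d → ℝ)} (hF : Convex ℝ F)
    {q : Fin d → ℝ} (hq : q ∈ F) (hqi : q ∉ intrinsicInterior ℝ F) :
    ∃ ψ : (Fin d → ℝ) →ₗ[ℝ] ℝ, (∀ x ∈ F, ψ x ≤ ψ q) ∧ ∃ x ∈ F, ψ x < ψ q := by
  have hne : Nonempty F := ⟨⟨q, hq⟩⟩
  let q' : affineSpan ℝ F := ⟨q, subset_affineSpan _ _ hq⟩
  let e : (affineSpan ℝ F).direction ≃ₜ affineSpan ℝ F := Homeomorph.vaddConst q'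
  let B : Set (affineSpan ℝ F) := (↑) ⁻¹' F
  have he : ∀ w, ((e w : affineSpan ℝ F) : Fin d → ℝ) = (w : Fin d → ℝ) + q := fun w => rfl
  have hG : Convex ℝ (e ⁻¹' B) := by
    intro a ha b hb s t hs ht hst
    change ((e _ : affineSpan ℝ F) : Fin d → ℝ) ∈ F
    have := hF ha hb hs ht hst
    simp only [he] at this ⊢
    convert this using 1
    simp only [Submodule.coe_add, Submodule.coe_smul, smul_add]
    have : q = s • q + t • q := by rw [← add_smul, hst, one_smul]
    nth_rewrite 1 [this]
    abel
  have hint : interior (e ⁻¹' B) = e ⁻¹' interior B := (e.preimage_interior B).symm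
  have hnon : (interior (e ⁻¹' B)).Nonempty := by
    obtain ⟨_, x, hx, rfl⟩ := Set.Nonempty.intrinsicInterior hF ⟨q, hq⟩
    rw [hint]
    exact ⟨e.symm x, by simpa using hx⟩
  have h0 : (0 : (affineSpan ℝ F).direction) ∉ interior (e ⁻¹' B) := by
    rw [hint]
    intro h
    exact hqi ⟨e 0, h, by simp [he]⟩
  obtain ⟨f, hf⟩ := geometric_hahn_banach_open_point hG.interior isOpen_interior h0
  have hle : ∀ a ∈ e ⁻¹' B, f a ≤ f 0 := by
    have hcl : closure (interior (e ⁻¹' B)) ⊆ {a | f a ≤ f 0} :=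
      closure_minimal (fun x hx => (hf x hx).le) (isClosed_le f.continuous continuous_const)
    intro a ha
    apply hcl
    rw [hG.closure_interior_eq_closure_of_nonempty_interior hnon]
    exact subset_closure ha
  obtain ⟨g, hg⟩ := LinearMap.exists_extend (f : (affineSpan ℝ F).direction →ₗ[ℝ] ℝ)
  have hgf : ∀ w : (affineSpan ℝ F).direction, g w = f w := fun w => LinearMap.congr_fun hg w
  refine ⟨g, fun x hx => ?_, ?_⟩
  · have := hle (e.symm ⟨x, subset_affineSpan _ _ hx⟩) (by simpa [B] using hx)
    rw [← hgf, map_zero] at this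
    have h2 := he (e.symm ⟨x, subset_affineSpan _ _ hx⟩)
    rw [Homeomorph.apply_symm_apply] at h2
    simp only at h2
    rw [h2, map_add]
    linarith
  · obtain ⟨a, ha⟩ := hnon
    refine ⟨(e a : Fin d → ℝ), show a ∈ e ⁻¹' B from interior_subset ha, ?_⟩
    have := hf a ha
    rw [← hgf, map_zero] at this
    rw [he, map_add]
    linarith

theorem eq_of_max_mem_intrinsicInterior {d : ℕ} {F : Set (Fin d → ℝ)}
    {q : Fin d → ℝ} (hq : q ∈ intrinsicInterior ℝ F) (φ : (Fin d → ℝ) →ₗ[ℝ] ℝ)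
    (hmax : ∀ x ∈ F, φ x ≤ φ q) : ∀ x ∈ F, φ x = φ q := by
  intro x hx
  refine le_antisymm (hmax x hx) ?_
  obtain ⟨q', hq', rfl⟩ := hq
  let x' : affineSpan ℝ F := ⟨x, subset_affineSpan _ _ hx⟩
  have hmem : ∀ t : ℝ, (q' : Fin d → ℝ) + t • (x - q') ∈ affineSpan ℝ F := fun t => by
    have := AffineMap.lineMap_mem t q'.2 x'.2
    rwa [AffineMap.lineMap_apply_module', add_comm] at this
  let l : ℝ → affineSpan ℝ F := fun t => ⟨(q' : Fin d → ℝ) + t • (x - q'), hmem t⟩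
  have hl : ∀ t, (l t : Fin d → ℝ) = (q' : Fin d → ℝ) + t • (x - q') := fun _ => rfl
  have hc : Continuous l := Continuous.subtype_mk (by fun_prop) _
  have hev : ∀ᶠ t in nhds (0 : ℝ), l t ∈ interior ((↑) ⁻¹' F : Set (affineSpan ℝ F)) := by
    apply hc.continuousAt.eventually
    apply isOpen_interior.mem_nhds
    have : l 0 = q' := Subtype.ext (by simp [hl])
    rwa [this]
  obtain ⟨ε, hε, hb⟩ := Metric.eventually_nhds_iff.1 hev
  have hd : dist (-(ε / 2)) 0 < ε := by
    rw [dist_zero_right, Real.norm_eq_abs, abs_neg, abs_of_pos] <;> linarith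
  have hin : l (-(ε / 2)) ∈ ((↑) ⁻¹' F : Set (affineSpan ℝ F)) := interior_subset (hb hd)
  have h1 := hmax _ hin
  rw [hl, map_add, map_smul, map_sub, smul_eq_mul] at h1
  nlinarith

theorem IsPolytope.convex {d : ℕ} {P : Set (Fin d → ℝ)} (h : IsPolytope P) : Convex ℝ P := by
  obtain ⟨V, -, rfl⟩ := h
  exact convex_convexHull ℝ _

theorem IsPolytope.isCompact {d : ℕ} {P : Set (Fin d → ℝ)} (h : IsPolytope P) : IsCompact P := by
  obtain ⟨V, -, rfl⟩ := h
  exact V.finite_toSet.isCompact_convexHull ℝ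

theorem IsPolytope.nonempty {d : ℕ} {P : Set (Fin d → ℝ)} (h : IsPolytope P) : P.Nonempty := by
  obtain ⟨V, hV, rfl⟩ := h
  exact hV.to_set.convexHull

theorem LinearMap.le_of_mem_convexHull {d : ℕ} {V : Set (Fin d → ℝ)}
    (φ : (Fin d → ℝ) →ₗ[ℝ] ℝ) {c : ℝ} (h : ∀ v ∈ V, φ v ≤ c) :
    ∀ x ∈ convexHull ℝ V, φ x ≤ c := fun _ hx =>
  convexHull_min (fun v hv => h v hv) (convex_halfSpace_le φ.isLinear c) hx

theorem IsPolytope.exists_face_mem_intrinsicInterior {d : ℕ} {P : Set (Fin d → ℝ)}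
    (hP : IsPolytope P) {q : Fin d → ℝ} (hq : q ∈ P) :
    ∃ F, IsFaceOf F P ∧ q ∈ intrinsicInterior ℝ F := by
  classical
  have hPc := hP.convex
  obtain ⟨V, -, hV⟩ := hP
  have hVP : ∀ v ∈ V, v ∈ P := fun v hv => hV ▸ subset_convexHull ℝ _ hv
  let slack : ((Fin d → ℝ) →ₗ[ℝ] ℝ) → ℕ := fun φ => (V.filter fun v => φ v < φ q).card
  let N : Set ℕ := {k | ∃ φ : (Fin d → ℝ) →ₗ[ℝ] ℝ, (∀ v ∈ V, φ v ≤ φ q) ∧ slack φ = k}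
  have hbdd : BddAbove N := ⟨V.card, by rintro _ ⟨φ, -, rfl⟩; exact Finset.card_filter_le _ _⟩
  obtain ⟨φ, hφ, hφN⟩ : sSup N ∈ N := Nat.sSup_mem ⟨_, 0, by simp, rfl⟩ hbdd
  have hφP : ∀ x ∈ P, φ x ≤ φ q := fun x hx => φ.le_of_mem_convexHull hφ x (hV ▸ hx)
  refine ⟨{x ∈ P | ∀ y ∈ P, φ y ≤ φ x}, ⟨⟨q, hq, hφP⟩, φ, rfl⟩, ?_⟩
  by_contra hcon
  have hFc : Convex ℝ {x ∈ P | ∀ y ∈ P, φ y ≤ φ x} := by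
    intro a ha b hb s t hs ht hst
    refine ⟨hPc ha.1 hb.1 hs ht hst, fun y hy => ?_⟩
    have h1 := ha.2 y hy
    have h2 := hb.2 y hy
    rw [map_add, map_smul, map_smul, smul_eq_mul, smul_eq_mul]
    calc φ y = s * φ y + t * φ y := by rw [← add_mul, hst, one_mul]
      _ ≤ _ := by gcongr
  obtain ⟨ψ, hψ, x, hx, hxψ⟩ := exists_supporting_functional hFc ⟨hq, hφP⟩ hcon
  have hVψ : ∀ v ∈ V, φ v = φ q → ψ v ≤ ψ q := fun v hv h =>
    hψ v ⟨hVP v hv, fun y hy => h ▸ hφP y hy⟩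
  obtain ⟨v₀, hv₀, hv₀φ, hv₀ψ⟩ : ∃ v ∈ V, φ v = φ q ∧ ψ v < ψ q := by
    by_contra! hno
    have hxV : x ∈ convexHull ℝ (V : Set (Fin d → ℝ)) := hV ▸ hx.1
    obtain ⟨w, hw0, hw1, hwx⟩ := Finset.mem_convexHull'.1 hxV
    have hφx : φ x = φ q := le_antisymm (hφP x hx.1) (hx.2 q hq)
    have hz : ∑ v ∈ V, w v * (φ q - φ v) = 0 := by
      rw [← hwx, map_sum] at hφx
      simp only [map_smul, smul_eq_mul] at hφx
      simp only [mul_sub, Finset.sum_sub_distrib, ← Finset.sum_mul, hw1, one_mul, hφx, sub_self]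
    rw [Finset.sum_eq_zero_iff_of_nonneg (fun v hv =>
      mul_nonneg (hw0 v hv) (sub_nonneg.2 (hφ v hv)))] at hz
    have : ψ q ≤ ψ x := by
      rw [← hwx, map_sum]
      simp only [map_smul, smul_eq_mul]
      calc ψ q = ∑ v ∈ V, w v * ψ q := by rw [← Finset.sum_mul, hw1, one_mul]
        _ ≤ _ := by
          refine Finset.sum_le_sum fun v hv => ?_
          rcases mul_eq_zero.1 (hz v hv) with h | h
          · simp [h]
          · exact mul_le_mul_of_nonneg_left (hno v hv (sub_eq_zero.1 h).symm) (hw0 v hv)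
    linarith
  obtain ⟨ε, hε, hεV⟩ : ∃ ε > 0, ∀ v ∈ V, φ v < φ q → φ v + ε * ψ v < φ q + ε * ψ q := by
    have hev : ∀ᶠ ε in nhdsWithin (0 : ℝ) (Set.Ioi 0),
        ∀ v ∈ V, φ v < φ q → φ v + ε * ψ v < φ q + ε * ψ q := by
      rw [Filter.eventually_all_finset]
      intro v _
      by_cases h : φ v < φ q
      · have hc : ContinuousAt (fun ε : ℝ => φ q + ε * ψ q - (φ v + ε * ψ v)) 0 := by fun_prop
        have := hc.eventually (lt_mem_nhds (show 0 < φ q + 0 * ψ q - (φ v + 0 * ψ v) by simpa))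
        filter_upwards [nhdsWithin_le_nhds this] with ε hε _
        linarith
      · simp [h]
    obtain ⟨ε, h1, h2⟩ := (hev.and self_mem_nhdsWithin).exists
    exact ⟨ε, h2, h1⟩
  have hmem : slack (φ + ε • ψ) ∈ N := by
    refine ⟨_, fun v hv => ?_, rfl⟩
    simp only [LinearMap.add_apply, LinearMap.smul_apply, smul_eq_mul]
    rcases (hφ v hv).lt_or_eq with h | h
    · exact (hεV v hv h).le
    · rw [h]
      gcongr
      exact hVψ v hv h
  have hlt : slack φ < slack (φ + ε • ψ) := by
    apply Finset.card_lt_card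
    rw [Finset.ssubset_iff_of_subset]
    · refine ⟨v₀, ?_, ?_⟩
      · simp only [Finset.mem_filter, LinearMap.add_apply, LinearMap.smul_apply, smul_eq_mul]
        refine ⟨hv₀, ?_⟩
        rw [hv₀φ]
        gcongr
      · simp [hv₀φ]
    · intro v hv
      simp only [Finset.mem_filter, LinearMap.add_apply, LinearMap.smul_apply, smul_eq_mul] at hv ⊢
      exact ⟨hv.1, hεV v hv.1 hv.2⟩
  have := le_csSup hbdd hmem
  omega

theorem mem_minkSum {d n : ℕ} {P : Fin n → Set (Fin d → ℝ)} {x : Fin d → ℝ} :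
    x ∈ minkSum P ↔ ∃ r : Fin n → Fin d → ℝ, (∀ i, r i ∈ P i) ∧ ∑ i, r i = x := by
  rw [minkSum, Set.mem_fintype_sum]
  simp only [exists_prop]

theorem sum_mem_minkSum {d n : ℕ} {P : Fin n → Set (Fin d → ℝ)} {r : Fin n → Fin d → ℝ}
    (h : ∀ i, r i ∈ P i) : ∑ i, r i ∈ minkSum P :=
  mem_minkSum.2 ⟨r, h, rfl⟩

theorem minkSum_mono {d n : ℕ} {P Q : Fin n → Set (Fin d → ℝ)} (h : ∀ i, P i ⊆ Q i) :
    minkSum P ⊆ minkSum Q := fun _ hx => by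
  obtain ⟨r, hr, rfl⟩ := mem_minkSum.1 hx
  exact sum_mem_minkSum fun i => h i (hr i)

theorem isPolytope_minkSum {d n : ℕ} {P : Fin n → Set (Fin d → ℝ)} (h : ∀ i, IsPolytope (P i)) :
    IsPolytope (minkSum P) := by
  classical
  choose V hV hPV using h
  refine ⟨∑ i, V i, ?_, ?_⟩
  · choose v hv using hV
    exact ⟨∑ i, v i, by
      rw [← Finset.mem_coe, Finset.coe_sum]
      exact Set.mem_fintype_sum _ _ |>.2 ⟨v, hv, rfl⟩⟩
  · rw [Finset.coe_sum, convexHull_sum, minkSum]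
    exact Finset.sum_congr rfl fun i _ => hPV i

theorem NPFace.subset {d n : ℕ} {F P : Fin n → Set (Fin d → ℝ)} (h : NPFace F P) (i : Fin n) :
    F i ⊆ P i := by
  obtain ⟨φ, hφ⟩ := h
  rw [(hφ i).2]
  exact fun _ hx => hx.1

theorem NPFace.mem_of_sum_mem {d n : ℕ} {F P : Fin n → Set (Fin d → ℝ)} (h : NPFace F P)
    {r : Fin n → Fin d → ℝ} (hr : ∀ i, r i ∈ P i) (hs : ∑ i, r i ∈ minkSum F) :
    ∀ i, r i ∈ F i := by
  have hsub := h.subset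
  obtain ⟨φ, hφ⟩ := h
  obtain ⟨s, hsF, hsr⟩ := mem_minkSum.1 hs
  have hle : ∀ i, ∀ y ∈ P i, φ y ≤ φ (s i) := fun i => by
    have := hsF i
    rw [(hφ i).2] at this
    exact this.2
  have hsum : ∑ i, φ (r i) = ∑ i, φ (s i) := by rw [← map_sum, ← map_sum, hsr]
  have heq := (Finset.sum_eq_sum_iff_of_le fun i _ => hle i (r i) (hr i)).1 hsum
  intro i
  rw [(hφ i).2]
  exact ⟨hr i, fun y hy => (hle i y hy).trans (heq i (Finset.mem_univ i)).ge⟩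

theorem NPFace.isFaceOf {d n : ℕ} {F P : Fin n → Set (Fin d → ℝ)} (h : NPFace F P) :
    IsFaceOf (minkSum F) (minkSum P) := by
  have hsub := h.subset
  have hmem := @NPFace.mem_of_sum_mem _ _ _ _ h
  obtain ⟨φ, hφ⟩ := h
  choose s hs using fun i => (hφ i).1
  have hle : ∀ i, ∀ t ∈ F i, ∀ y ∈ P i, φ y ≤ φ t := fun i t ht => by
    rw [(hφ i).2] at ht
    exact ht.2
  refine ⟨⟨_, sum_mem_minkSum hs⟩, φ, Set.ext fun x => ⟨fun hx => ?_, ?_⟩⟩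
  · refine ⟨minkSum_mono hsub hx, fun y hy => ?_⟩
    obtain ⟨t, ht, rfl⟩ := mem_minkSum.1 hx
    obtain ⟨r, hr, rfl⟩ := mem_minkSum.1 hy
    rw [map_sum, map_sum]
    exact Finset.sum_le_sum fun i _ => hle i _ (ht i) _ (hr i)
  · rintro ⟨hx, hmax⟩
    obtain ⟨r, hr, rfl⟩ := mem_minkSum.1 hx
    have h1 := hmax _ (sum_mem_minkSum fun i => hsub i (hs i))
    rw [map_sum, map_sum] at h1
    have h2 : ∀ i ∈ Finset.univ, φ (r i) ≤ φ (s i) := fun i _ => hle i _ (hs i) _ (hr i)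
    have heq := (Finset.sum_eq_sum_iff_of_le h2).1 (le_antisymm (Finset.sum_le_sum h2) h1)
    refine sum_mem_minkSum fun i => ?_
    rw [(hφ i).2]
    exact ⟨hr i, fun y hy => (hle i _ (hs i) y hy).trans (heq i (Finset.mem_univ i)).ge⟩

/-- `(𝒜, p)` is a perfect `n𝒫`-poset. -/
structure IsPerfectPoset {d n : ℕ} {𝒜 : Type*} [PartialOrder 𝒜]
    (p : 𝒜 → Fin n → Set (Fin d → ℝ)) : Prop where
  isPolytope : ∀ x i, IsPolytope (p x i)
  npFace : ∀ x y : 𝒜, x ≤ y → NPFace (p x) (p y)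
  isAComplex_Iic : ∀ x : 𝒜, IsAComplex p {y | y ≤ x}

theorem mem_suppOf {d n : ℕ} {𝒜 : Type*} {p : 𝒜 → Fin n → Set (Fin d → ℝ)}
    {X : Set 𝒜} {q : Fin d → ℝ} :
    q ∈ suppOf p X ↔ ∃ x ∈ X, q ∈ minkSum (p x) := by
  simp [suppOf]

theorem mem_nsuppOf {d n : ℕ} {𝒜 : Type*} {p : 𝒜 → Fin n → Set (Fin d → ℝ)}
    {X : Set 𝒜} {k : Fin n} {q : Fin d → ℝ} :
    q ∈ nsuppOf p X k ↔ ∃ x ∈ X, q ∈ p x k := by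
  simp [nsuppOf]

section Complex

variable {d n : ℕ} {𝒜 : Type*} [PartialOrder 𝒜] {p : 𝒜 → Fin n → Set (Fin d → ℝ)}

theorem IsAComplex.finite {X : Set 𝒜} (hX : IsAComplex p X) : X.Finite :=
  Set.Finite.of_finite_image hX.1.1 hX.2.1

theorem IsAComplex.eq_of_mem_intrinsicInterior {X : Set 𝒜} (hX : IsAComplex p X) {u v : 𝒜}
    (hu : u ∈ X) (hv : v ∈ X) {q : Fin d → ℝ} (hqu : q ∈ intrinsicInterior ℝ (minkSum (p u)))
    (hqv : q ∈ intrinsicInterior ℝ (minkSum (p v))) : u = v := by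
  by_contra hne
  have := hX.1.2.2.2 _ ⟨u, hu, rfl⟩ _ ⟨v, hv, rfl⟩ fun h => hne (hX.2.1 hu hv h)
  exact (Set.ext_iff.1 this q).1 ⟨hqu, hqv⟩

namespace IsPerfectPoset

variable (hp : IsPerfectPoset p)
include hp

theorem isPolytope_minkSum (x : 𝒜) : IsPolytope (minkSum (p x)) :=
  _root_.isPolytope_minkSum (hp.isPolytope x)

theorem subset {x y : 𝒜} (h : x ≤ y) (i : Fin n) : p x i ⊆ p y i :=
  (hp.npFace x y h).subset i

theorem minkSum_subset {x y : 𝒜} (h : x ≤ y) : minkSum (p x) ⊆ minkSum (p y) :=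
  minkSum_mono (hp.subset h)

theorem intrinsicInterior_nonempty (x : 𝒜) :
    (intrinsicInterior ℝ (minkSum (p x))).Nonempty :=
  Set.Nonempty.intrinsicInterior (hp.isPolytope_minkSum x).convex (hp.isPolytope_minkSum x).nonempty

theorem exists_le_of_isFaceOf {x : 𝒜} {F : Set (Fin d → ℝ)} (hF : IsFaceOf F (minkSum (p x))) :
    ∃ y ≤ x, minkSum (p y) = F :=
  (hp.isAComplex_Iic x).1.2.2.1 _ ⟨x, le_refl x, rfl⟩ F hF

theorem isLowerSet {X : Set 𝒜} (hX : IsAComplex p X) : IsLowerSet X := by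
  intro v u huv hv
  obtain ⟨u', hu', he⟩ := hX.1.2.2.1 _ ⟨v, hv, rfl⟩ _ (hp.npFace u v huv).isFaceOf
  have hle : u' ≤ v := (hX.2.2 u' hu' v hv).2 (by
    have := (hp.npFace u v huv).isFaceOf
    rwa [← he] at this)
  rwa [← (hp.isAComplex_Iic v).2.1 hle huv he]

theorem isAComplex_of_isLowerSet {X : Set 𝒜} (hfin : X.Finite) (hlow : IsLowerSet X)
    (hsep : ∀ u ∈ X, ∀ v ∈ X, ∀ q, q ∈ intrinsicInterior ℝ (minkSum (p u)) →
      q ∈ intrinsicInterior ℝ (minkSum (p v)) → u = v) : IsAComplex p X := by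
  have hinj : Set.InjOn (fun x => minkSum (p x)) X := by
    intro u hu v hv he
    obtain ⟨q, hq⟩ := hp.intrinsicInterior_nonempty u
    exact hsep u hu v hv q hq (by simp only at he; rwa [← he])
  refine ⟨⟨hfin.image _, ?_, ?_, ?_⟩, hinj, ?_⟩
  · rintro _ ⟨x, -, rfl⟩
    exact hp.isPolytope_minkSum x
  · rintro _ ⟨x, hx, rfl⟩ F hF
    obtain ⟨y, hy, rfl⟩ := hp.exists_le_of_isFaceOf hF
    exact ⟨y, hlow hy hx, rfl⟩
  · rintro _ ⟨x, hx, rfl⟩ _ ⟨y, hy, rfl⟩ hne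
    by_contra hcon
    obtain ⟨q, hqx, hqy⟩ := Set.nonempty_iff_ne_empty.2 hcon
    exact hne (by rw [hsep x hx y hy q hqx hqy])
  · intro x hx y hy
    refine ⟨fun h => (hp.npFace x y h).isFaceOf, fun h => ?_⟩
    obtain ⟨x', hx', he⟩ := hp.exists_le_of_isFaceOf h
    rwa [← hinj (hlow hx' hy) hx he]

theorem isAComplex_of_subset {X Y : Set 𝒜} (hX : IsAComplex p X) (hYX : Y ⊆ X)
    (hY : IsLowerSet Y) : IsAComplex p Y :=
  hp.isAComplex_of_isLowerSet (hX.finite.subset hYX) hY fun _ hu _ hv _ hqu hqv =>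
    hX.eq_of_mem_intrinsicInterior (hYX hu) (hYX hv) hqu hqv

theorem exists_carrier {X : Set 𝒜} (hX : IsAComplex p X) {q : Fin d → ℝ} (hq : q ∈ suppOf p X) :
    ∃ u ∈ X, q ∈ intrinsicInterior ℝ (minkSum (p u)) ∧ ∀ z ∈ X, q ∈ minkSum (p z) → u ≤ z := by
  have key : ∀ z ∈ X, q ∈ minkSum (p z) →
      ∃ u ∈ X, u ≤ z ∧ q ∈ intrinsicInterior ℝ (minkSum (p u)) := by
    intro z hz hqz
    obtain ⟨F, hF, hqF⟩ := (hp.isPolytope_minkSum z).exists_face_mem_intrinsicInterior hqz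
    obtain ⟨u, hu, rfl⟩ := hp.exists_le_of_isFaceOf hF
    exact ⟨u, hp.isLowerSet hX hu hz, hu, hqF⟩
  obtain ⟨z, hz, hqz⟩ := mem_suppOf.1 hq
  obtain ⟨u, hu, -, hqu⟩ := key z hz hqz
  refine ⟨u, hu, hqu, fun z' hz' hqz' => ?_⟩
  obtain ⟨u', hu', hle, hqu'⟩ := key z' hz' hqz'
  rwa [hX.eq_of_mem_intrinsicInterior hu hu' hqu hqu']

end IsPerfectPoset

end Complex

section Mixed

variable {d n : ℕ} {𝒜 : Type*} [PartialOrder 𝒜] {p : 𝒜 → Fin n → Set (Fin d → ℝ)}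

namespace IsPerfectPoset

variable (hp : IsPerfectPoset p)
include hp

theorem isClosed_suppOf {X : Set 𝒜} (hX : X.Finite) : IsClosed (suppOf p X) :=
  hX.isClosed_biUnion fun x _ => (hp.isPolytope_minkSum x).isCompact.isClosed

theorem exists_step {X : Set 𝒜} (hX : IsAComplex p X) (hconv : Convex ℝ (suppOf p X)) {z : 𝒜}
    (hz : z ∈ X) {r : Fin n → Fin d → ℝ} (hr : ∀ j, r j ∈ p z j) {m : Fin d → ℝ}
    (hm : m ∈ suppOf p X) :
    ∃ z' ∈ X, ∃ ε : ℝ, 0 < ε ∧ ∃ r' : Fin n → Fin d → ℝ, (∀ j, r j ∈ p z' j) ∧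
      (∀ j, r' j ∈ p z' j) ∧ ∑ j, r' j = ∑ j, r j + ε • (m - ∑ j, r j) := by
  set q := ∑ j, r j with hq
  have hqX : q ∈ suppOf p X := mem_suppOf.2 ⟨z, hz, sum_mem_minkSum hr⟩
  have hseg : ∀ᶠ ε in nhdsWithin (0 : ℝ) (Set.Ioi 0), q + ε • (m - q) ∈ suppOf p X := by
    filter_upwards [Ioc_mem_nhdsGT (zero_lt_one' ℝ)] with ε hε
    exact hconv.add_smul_sub_mem hqX hm ⟨hε.1.le, hε.2⟩
  obtain ⟨z', hz', hfreq⟩ : ∃ z' ∈ X,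
      ∃ᶠ ε in nhdsWithin (0 : ℝ) (Set.Ioi 0), q + ε • (m - q) ∈ minkSum (p z') := by
    by_contra! hno
    have hall := (Filter.eventually_all_finite hX.finite).2 hno
    obtain ⟨ε, h1, h2⟩ := (hseg.and hall).exists
    obtain ⟨z', hz', h3⟩ := mem_suppOf.1 h1
    exact h2 z' hz' h3
  have hqz' : q ∈ minkSum (p z') := by
    refine (hp.isPolytope_minkSum z').isCompact.isClosed.mem_of_frequently_of_tendsto hfreq ?_
    have hc : ContinuousAt (fun ε : ℝ => q + ε • (m - q)) 0 := by fun_prop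
    have := hc.tendsto
    simp only [zero_smul, add_zero] at this
    exact this.mono_left nhdsWithin_le_nhds
  obtain ⟨ε, hmem, hε⟩ := (hfreq.and_eventually self_mem_nhdsWithin).exists
  obtain ⟨r', hr', hr'q⟩ := mem_minkSum.1 hmem
  obtain ⟨u, hu, hqu, hle⟩ := hp.exists_carrier hX hqX
  have hru := (hp.npFace u z (hle z hz (sum_mem_minkSum hr))).mem_of_sum_mem hr
    (intrinsicInterior_subset hqu)
  exact ⟨z', hz', ε, hε, r', fun j => hp.subset (hle z' hz' hqz') j (hru j), hr', hr'q⟩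

theorem exists_tuple_max {X : Set 𝒜} (hX : IsAComplex p X) (hconv : Convex ℝ (suppOf p X))
    {k : Fin n} {s : Fin d → ℝ} (hs : s ∈ nsuppOf p X k) (φ : (Fin d → ℝ) →ₗ[ℝ] ℝ)
    (hφ : ∀ z ∈ X, s ∈ p z k → ∀ s' ∈ p z k, φ s' ≤ φ s) :
    ∃ z ∈ X, ∃ r : Fin n → Fin d → ℝ, (∀ j, r j ∈ p z j) ∧ r k = s ∧
      ∀ m ∈ suppOf p X, φ m ≤ φ (∑ j, r j) := by
  classical
  let T : Set (Fin n → Fin d → ℝ) := ⋃ z ∈ X, (Set.univ.pi (p z) ∩ {r | r k = s})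
  have hT : ∀ r, r ∈ T ↔ ∃ z ∈ X, (∀ j, r j ∈ p z j) ∧ r k = s := by
    intro r
    simp [T, and_left_comm]
  have hTc : IsCompact T := hX.finite.isCompact_biUnion fun z _ =>
    (isCompact_univ_pi fun j => (hp.isPolytope z j).isCompact).inter_right
      (isClosed_eq (continuous_apply k) continuous_const)
  have hupd : ∀ z (r : Fin n → Fin d → ℝ), (∀ j, r j ∈ p z j) → s ∈ p z k →
      ∀ j, Function.update r k s j ∈ p z j := by
    intro z r hr hsz j
    rcases eq_or_ne j k with rfl | hj
    · simpa using hsz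
    · simpa [hj] using hr j
  have hTn : T.Nonempty := by
    obtain ⟨z, hz, hsz⟩ := mem_nsuppOf.1 hs
    choose r hr using fun j => (hp.isPolytope z j).nonempty
    exact ⟨Function.update r k s, (hT _).2 ⟨z, hz, hupd z r hr hsz, by simp⟩⟩
  have hcont : Continuous fun r : Fin n → Fin d → ℝ => φ (∑ j, r j) :=
    φ.continuous_of_finiteDimensional.comp (by fun_prop)
  obtain ⟨r, hrT, hmax⟩ := hTc.exists_isMaxOn hTn hcont.continuousOn
  obtain ⟨z, hz, hr, hrk⟩ := (hT r).1 hrT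
  refine ⟨z, hz, r, hr, hrk, fun m hm => ?_⟩
  obtain ⟨z', hz', ε, hε, r', hrz', hr', hsum⟩ := hp.exists_step hX hconv hz hr hm
  have hsz' : s ∈ p z' k := hrk ▸ hrz' k
  have h1 : φ (∑ j, Function.update r' k s j) ≤ φ (∑ j, r j) :=
    hmax ((hT _).2 ⟨z', hz', hupd z' r' hr' hsz', by simp⟩)
  rw [Finset.sum_update_of_mem (Finset.mem_univ k), map_add] at h1
  have h2 := congrArg φ hsum
  rw [← Finset.add_sum_erase _ _ (Finset.mem_univ k), ← Finset.sdiff_singleton_eq_erase, map_add,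
    map_add, map_smul, map_sub, smul_eq_mul] at h2
  have h3 := hφ z' hz' hsz' _ (hr' k)
  nlinarith

theorem nsuppOf_eq {X : Set 𝒜} (hX : IsAComplex p X) {P : Fin n → Set (Fin d → ℝ)}
    (hP : ∀ j, IsPolytope (P j)) (hsub : ∀ z ∈ X, ∀ j, p z j ⊆ P j)
    (hsupp : suppOf p X = minkSum P) : nsuppOf p X = P := by
  classical
  have hconv : Convex ℝ (suppOf p X) := hsupp ▸ (_root_.isPolytope_minkSum hP).convex
  funext k
  refine Set.Subset.antisymm (fun t ht => ?_) fun t ht => ?_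
  · obtain ⟨z, hz, htz⟩ := mem_nsuppOf.1 ht
    exact hsub z hz k htz
  have hNc : IsCompact (nsuppOf p X k) :=
    hX.finite.isCompact_biUnion fun z _ => (hp.isPolytope z k).isCompact
  have hNn : (nsuppOf p X k).Nonempty := by
    obtain ⟨q, hq⟩ := (_root_.isPolytope_minkSum hP).nonempty
    rw [← hsupp] at hq
    obtain ⟨z, hz, -⟩ := mem_suppOf.1 hq
    obtain ⟨a, ha⟩ := (hp.isPolytope z k).nonempty
    exact ⟨a, mem_nsuppOf.2 ⟨z, hz, ha⟩⟩
  obtain ⟨s, hs, hmin⟩ := hNc.exists_isMinOn hNn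
    (f := fun a => ∑ i, (t i - a i) ^ 2) (by fun_prop)
  let φ : (Fin d → ℝ) →ₗ[ℝ] ℝ := ∑ i, (t i - s i) • LinearMap.proj i
  have hφ : ∀ a, φ a = ∑ i, (t i - s i) * a i := fun a => by simp [φ, LinearMap.sum_apply]
  obtain ⟨z, hz, r, hr, hrk, hmax⟩ := hp.exists_tuple_max hX hconv hs φ (by
    intro z hz hsz s' hs'
    by_contra! hlt
    set a := ∑ i, (t i - s i) * (s' i - s i) with ha
    set b := ∑ i, (s' i - s i) ^ 2 with hb
    have hb0 : 0 ≤ b := Finset.sum_nonneg fun i _ => sq_nonneg _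
    have ha0 : 0 < a := by
      rw [hφ, hφ] at hlt
      simp only [ha, mul_sub, Finset.sum_sub_distrib]
      linarith
    set ε := a / (a + b + 1) with hε
    have hε0 : 0 < ε := by positivity
    have hε1 : ε ≤ 1 := by rw [hε, div_le_one (by positivity)]; linarith
    have hin : s + ε • (s' - s) ∈ nsuppOf p X k :=
      mem_nsuppOf.2 ⟨z, hz, (hp.isPolytope z k).convex.add_smul_sub_mem hsz hs' ⟨hε0.le, hε1⟩⟩
    have h1 : ∑ i, (t i - s i) ^ 2 ≤ ∑ i, (t i - (s + ε • (s' - s)) i) ^ 2 := hmin hin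
    have h2 : ∑ i, (t i - (s + ε • (s' - s)) i) ^ 2
        = ∑ i, (t i - s i) ^ 2 - 2 * ε * a + ε ^ 2 * b := by
      rw [ha, hb, Finset.mul_sum, Finset.mul_sum, ← Finset.sum_sub_distrib,
        ← Finset.sum_add_distrib]
      refine Finset.sum_congr rfl fun i _ => ?_
      simp only [Pi.add_apply, Pi.smul_apply, Pi.sub_apply, smul_eq_mul]
      ring
    have h3 : ε * (a + b + 1) = a := div_mul_cancel₀ _ (by positivity)
    have h4 : 2 * a ≤ ε * b := by
      have : ε * (2 * a) ≤ ε * (ε * b) := by nlinarith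
      exact le_of_mul_le_mul_left this hε0
    nlinarith)
  have hupd : ∀ j, Function.update r k t j ∈ P j := by
    intro j
    rcases eq_or_ne j k with rfl | hj
    · simpa using ht
    · simpa [hj] using hsub z hz j (hr j)
  have h1 := hmax (∑ j, Function.update r k t j) (hsupp ▸ sum_mem_minkSum hupd)
  rw [Finset.sum_update_of_mem (Finset.mem_univ k), ← Finset.add_sum_erase _ r (Finset.mem_univ k),
    ← Finset.sdiff_singleton_eq_erase, map_add, map_add, hrk, hφ t, hφ s] at h1
  have h2 : ∑ i, (t i - s i) ^ 2 ≤ 0 := by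
    have : ∑ i, (t i - s i) ^ 2 = ∑ i, (t i - s i) * t i - ∑ i, (t i - s i) * s i := by
      rw [← Finset.sum_sub_distrib]
      exact Finset.sum_congr rfl fun i _ => by ring
    linarith
  have h3 := (Finset.sum_eq_zero_iff_of_nonneg fun i _ => sq_nonneg (t i - s i)).1
    (le_antisymm h2 (Finset.sum_nonneg fun i _ => sq_nonneg _))
  have : t = s := funext fun i => by
    have := h3 i (Finset.mem_univ i)
    have := pow_eq_zero_iff (two_ne_zero) |>.1 this
    linarith
  rwa [this]

theorem suppOf_eq_minkSum {X : Set 𝒜} (hX : IsASubdivision p X) {P : Fin n → Set (Fin d → ℝ)}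
    (hP : ∀ j, IsPolytope (P j)) (hN : nsuppOf p X = P) : suppOf p X = minkSum P := by
  classical
  obtain ⟨hX, hQ⟩ := hX
  have hsub : ∀ z ∈ X, ∀ j, p z j ⊆ P j := fun z hz j t ht =>
    hN ▸ mem_nsuppOf.2 ⟨z, hz, ht⟩
  refine Set.Subset.antisymm (fun q hq => ?_) fun w hw => ?_
  · obtain ⟨z, hz, hqz⟩ := mem_suppOf.1 hq
    exact minkSum_mono (hsub z hz) hqz
  by_contra hwQ
  obtain ⟨f, c, hfc, hcw⟩ := geometric_hahn_banach_closed_point hQ.convex hQ.isCompact.isClosed hwQ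
  let φ : (Fin d → ℝ) →ₗ[ℝ] ℝ := f
  have hfφ : ∀ a, f a = φ a := fun _ => rfl
  obtain ⟨q₀, hq₀, hmax₀⟩ := hQ.isCompact.exists_isMaxOn hQ.nonempty f.continuous.continuousOn
  choose s hsP hsmax using fun k =>
    (hP k).isCompact.exists_isMaxOn (hP k).nonempty f.continuous.continuousOn
  have hconst : ∀ q ∈ suppOf p X, (∀ m ∈ suppOf p X, φ m ≤ φ q) → ∀ u ∈ X,
      q ∈ intrinsicInterior ℝ (minkSum (p u)) → ∀ k, ∀ t ∈ p u k, ∀ t' ∈ p u k, φ t = φ t' := by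
    intro q hq hmax u hu hqu k t ht t' ht'
    have hc := eq_of_max_mem_intrinsicInterior hqu φ fun x hx => hmax x (mem_suppOf.2 ⟨u, hu, hx⟩)
    choose r hr using fun j => (hp.isPolytope u j).nonempty
    have hupd : ∀ a ∈ p u k, φ a + φ (∑ j ∈ Finset.univ \ {k}, r j) = φ q := by
      intro a ha
      rw [← map_add, ← Finset.sum_update_of_mem (Finset.mem_univ k)]
      refine hc _ (sum_mem_minkSum fun j => ?_)
      rcases eq_or_ne j k with rfl | hj
      · simpa using ha
      · simpa [hj] using hr j
    linarith [hupd t ht, hupd t' ht']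
  obtain ⟨u₀, hu₀, hqu₀, -⟩ := hp.exists_carrier hX hq₀
  have hval : ∀ k, ∀ t ∈ p u₀ k, φ t = φ (s k) := by
    intro k
    obtain ⟨z, hz, r, hr, hrk, hmax⟩ := hp.exists_tuple_max hX hQ.convex (k := k) (s := s k)
      (by rw [hN]; exact hsP k) φ fun z hz _ s' hs' => hsmax k (hsub z hz k hs')
    let C : Set (Fin d → ℝ) := {q | q ∈ suppOf p X ∧ ∀ m ∈ suppOf p X, φ m ≤ φ q}
    let A : Set 𝒜 := {u | u ∈ X ∧ ∀ t ∈ p u k, φ t = φ (s k)}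
    let B : Set 𝒜 := {u | u ∈ X ∧ ∀ t ∈ p u k, φ t ≠ φ (s k)}
    have hAB : ∀ q ∈ C, ∀ u ∈ X, q ∈ intrinsicInterior ℝ (minkSum (p u)) → u ∈ A ∨ u ∈ B := by
      intro q hq u hu hqu
      have hc := hconst q hq.1 hq.2 u hu hqu k
      by_cases h : ∃ t ∈ p u k, φ t = φ (s k)
      · obtain ⟨t, ht, he⟩ := h
        exact Or.inl ⟨hu, fun t' ht' => (hc t' ht' t ht).trans he⟩
      · push Not at h
        exact Or.inr ⟨hu, h⟩
    have hC : Convex ℝ C := by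
      intro a ha b hb x y hx hy hxy
      refine ⟨hQ.convex ha.1 hb.1 hx hy hxy, fun m hm => ?_⟩
      rw [map_add, map_smul, map_smul, smul_eq_mul, smul_eq_mul]
      calc φ m = x * φ m + y * φ m := by rw [← add_mul, hxy, one_mul]
        _ ≤ _ := by
          have h1 := ha.2 m hm
          have h2 := hb.2 m hm
          gcongr
    have hq₀C : q₀ ∈ C := ⟨hq₀, fun m hm => hmax₀ hm⟩
    have hA : (C ∩ suppOf p A).Nonempty := by
      have hqX : ∑ j, r j ∈ suppOf p X := mem_suppOf.2 ⟨z, hz, sum_mem_minkSum hr⟩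
      obtain ⟨u, hu, hqu, hle⟩ := hp.exists_carrier hX hqX
      have hru := (hp.npFace u z (hle z hz (sum_mem_minkSum hr))).mem_of_sum_mem hr
        (intrinsicInterior_subset hqu)
      refine ⟨_, ⟨hqX, hmax⟩, mem_suppOf.2 ⟨u, ⟨hu, fun t ht => ?_⟩, intrinsicInterior_subset hqu⟩⟩
      rw [hconst _ hqX hmax u hu hqu k t ht _ (hru k), hrk]
    rcases hAB q₀ hq₀C u₀ hu₀ hqu₀ with h | h
    · exact h.2
    · exfalso
      obtain ⟨q, hqC, hqA, hqB⟩ := isPreconnected_closed_iff.1 hC.isPreconnected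
        (suppOf p A) (suppOf p B) (hp.isClosed_suppOf (hX.finite.subset fun u hu => hu.1))
        (hp.isClosed_suppOf (hX.finite.subset fun u hu => hu.1))
        (by
          intro q hq
          obtain ⟨u, hu, hqu, -⟩ := hp.exists_carrier hX hq.1
          exact (hAB q hq u hu hqu).imp
            (fun h => mem_suppOf.2 ⟨u, h, intrinsicInterior_subset hqu⟩)
            (fun h => mem_suppOf.2 ⟨u, h, intrinsicInterior_subset hqu⟩))
        hA ⟨q₀, hq₀C, mem_suppOf.2 ⟨u₀, h, intrinsicInterior_subset hqu₀⟩⟩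
      obtain ⟨a, ha, hqa⟩ := mem_suppOf.1 hqA
      obtain ⟨b, hb, hqb⟩ := mem_suppOf.1 hqB
      obtain ⟨v, hv, -, hle⟩ := hp.exists_carrier hX hqC.1
      obtain ⟨t, ht⟩ := (hp.isPolytope v k).nonempty
      exact hb.2 t (hp.subset (hle b hb.1 hqb) k ht) (ha.2 t (hp.subset (hle a ha.1 hqa) k ht))
  obtain ⟨r, hr, hrq⟩ := mem_minkSum.1 (intrinsicInterior_subset hqu₀)
  obtain ⟨v, hv, rfl⟩ := mem_minkSum.1 hw
  have h1 := hfc q₀ hq₀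
  have h2 : f (∑ i, v i) ≤ f q₀ := by
    rw [← hrq, map_sum, map_sum]
    refine Finset.sum_le_sum fun i _ => ?_
    have := hval i _ (hr i)
    rw [hfφ (r i), this]
    exact hsmax i (hv i)
  linarith

theorem restriction {X : Set 𝒜} (hX : IsAComplex p X) {x y : 𝒜} (hyx : y ≤ x)
    (hsupp : suppOf p X = minkSum (p x)) (hsub : ∀ z ∈ X, ∀ j, p z j ⊆ p x j) :
    IsAComplex p {z | z ∈ X ∧ minkSum (p z) ⊆ minkSum (p y)} ∧
      suppOf p {z | z ∈ X ∧ minkSum (p z) ⊆ minkSum (p y)} = minkSum (p y) ∧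
      nsuppOf p {z | z ∈ X ∧ minkSum (p z) ⊆ minkSum (p y)} = p y := by
  have hY : IsAComplex p {z | z ∈ X ∧ minkSum (p z) ⊆ minkSum (p y)} :=
    hp.isAComplex_of_subset hX (fun _ h => h.1) fun a b hba ha =>
      ⟨hp.isLowerSet hX hba ha.1, (hp.minkSum_subset hba).trans ha.2⟩
  have hsY : suppOf p {z | z ∈ X ∧ minkSum (p z) ⊆ minkSum (p y)} = minkSum (p y) := by
    refine Set.Subset.antisymm (fun q hq => ?_) fun q hq => ?_
    · obtain ⟨z, hz, hqz⟩ := mem_suppOf.1 hq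
      exact hz.2 hqz
    · have hqX : q ∈ suppOf p X := hsupp ▸ hp.minkSum_subset hyx hq
      obtain ⟨u, hu, hqu, -⟩ := hp.exists_carrier hX hqX
      refine mem_suppOf.2 ⟨u, ⟨hu, fun a ha => ?_⟩, intrinsicInterior_subset hqu⟩
      have hux : minkSum (p u) ⊆ minkSum (p x) := minkSum_mono (hsub u hu)
      obtain ⟨-, φ, hφ⟩ := (hp.npFace y x hyx).isFaceOf
      rw [hφ] at hq ⊢
      have := eq_of_max_mem_intrinsicInterior hqu φ fun b hb => hq.2 b (hux hb)
      exact ⟨hux ha, fun b hb => (hq.2 b hb).trans (this a ha).ge⟩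
  refine ⟨hY, hsY, hp.nsuppOf_eq hY (hp.isPolytope y) (fun z hz j t ht => ?_) hsY⟩
  classical
  choose r hr using fun j => (hp.isPolytope z j).nonempty
  have hupd : ∀ i, Function.update r j t i ∈ p z i := by
    intro i
    rcases eq_or_ne i j with rfl | hi
    · simpa using ht
    · simpa [hi] using hr i
  have := (hp.npFace y x hyx).mem_of_sum_mem (fun i => hsub z hz.1 i (hupd i))
    (hz.2 (sum_mem_minkSum hupd)) j
  simpa using this

end IsPerfectPoset

end Mixed

section Rewriting

variable {𝒜 : Type*} [PartialOrder 𝒜] {ι : Type*} {A : ι → Set 𝒜} {σ : ι → 𝒜 → Set 𝒜}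

theorem terminalSet_singleton {x : 𝒜} :
    TerminalSet A σ {x} ↔ ∀ α, x ∈ A α → MaxElems (σ α x) = {x} := by
  refine ⟨fun h α hx => ?_, ?_⟩
  · simpa using h _ ⟨α, x, rfl, hx, rfl⟩
  · rintro h _ ⟨α, y, rfl, hy, rfl⟩
    simp [h α hy]

theorem TerminalSet.eq_of_movesTo {X Y : Set 𝒜} (hX : TerminalSet A σ X)
    (h : MovesTo A σ X Y) : Y = X := by
  induction h with
  | refl => rfl
  | tail _ hmove ih => subst ih; exact hX _ hmove

theorem MovesTo.eq_or_exists {X Y : Set 𝒜} (h : MovesTo A σ X Y) :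
    Y = X ∨ ∃ Z, MoveTo A σ X Z ∧ X ≠ Z ∧ MovesTo A σ Z Y := by
  induction h using Relation.ReflTransGen.head_induction_on with
  | refl => exact Or.inl rfl
  | @head X Z hXZ hZY ih =>
    by_cases he : X = Z
    · rwa [he]
    · exact Or.inr ⟨Z, hXZ, he, hZY⟩

variable (A σ) in
/-- A rewriting system on finite sets whose moves are locally confluent and terminating, and in
which an element is maximal in its own subdivision only if that subdivision is trivial. -/
structure IsConvergentSystem : Prop where
  finite : ∀ α, ∀ x ∈ A α, (σ α x).Finite
  maxElems_eq : ∀ α, ∀ x ∈ A α, x ∈ MaxElems (σ α x) → MaxElems (σ α x) = {x}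
  locallyConfluent : ∀ X : Set 𝒜, X.Finite → ∀ Y₁ Y₂, MoveTo A σ X Y₁ → MoveTo A σ X Y₂ →
    Joinable A σ Y₁ Y₂
  terminating : ¬ ∃ f : ℕ → Set 𝒜, (∀ k, (f k).Finite) ∧
    ∀ k, MoveTo A σ (f k) (f (k + 1)) ∧ f k ≠ f (k + 1)

variable (A σ) in
open Classical in
/-- A terminal set reachable from `X` (and `X` itself if there is none). -/
noncomputable def normalForm (X : Set 𝒜) : Set 𝒜 :=
  if h : ∃ Z, TerminalSet A σ Z ∧ MovesTo A σ X Z then h.choose else X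

namespace IsConvergentSystem

variable (hA : IsConvergentSystem A σ)
include hA

theorem finite_of_moveTo {X Y : Set 𝒜} (hX : X.Finite) (h : MoveTo A σ X Y) : Y.Finite := by
  obtain ⟨α, x, -, hx, rfl⟩ := h
  exact hX.sdiff.union ((hA.finite α x hx).subset fun _ h => h.1)

theorem finite_of_movesTo {X Y : Set 𝒜} (hX : X.Finite) (h : MovesTo A σ X Y) : Y.Finite := by
  induction h with
  | refl => exact hX
  | tail _ hmove ih => exact hA.finite_of_moveTo ih hmove

theorem wellFounded_moveTo :
    WellFounded fun Y X : Set 𝒜 => X.Finite ∧ MoveTo A σ X Y ∧ X ≠ Y :=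
  wellFounded_iff_isEmpty_descending_chain.2
    ⟨fun f => hA.terminating ⟨f.1, fun k => (f.2 k).1, fun k => (f.2 k).2⟩⟩

/-- Newman's lemma. -/
theorem joinable {X : Set 𝒜} (hX : X.Finite) {Y₁ Y₂ : Set 𝒜} (h₁ : MovesTo A σ X Y₁)
    (h₂ : MovesTo A σ X Y₂) : Joinable A σ Y₁ Y₂ := by
  induction X using hA.wellFounded_moveTo.induction generalizing Y₁ Y₂ with
  | _ X ih =>
    rcases h₁.eq_or_exists with rfl | ⟨Z₁, hm₁, hne₁, hZ₁⟩
    · exact ⟨Y₂, h₂, .refl⟩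
    rcases h₂.eq_or_exists with rfl | ⟨Z₂, hm₂, hne₂, hZ₂⟩
    · exact ⟨Y₁, .refl, h₁⟩
    obtain ⟨W, hW₁, hW₂⟩ := hA.locallyConfluent X hX Z₁ Z₂ hm₁ hm₂
    obtain ⟨V, hV₁, hWV⟩ :=
      ih Z₁ ⟨hX, hm₁, hne₁⟩ (hA.finite_of_moveTo hX hm₁) hZ₁ hW₁
    obtain ⟨U, hU₂, hVU⟩ :=
      ih Z₂ ⟨hX, hm₂, hne₂⟩ (hA.finite_of_moveTo hX hm₂) hZ₂ (hW₂.trans hWV)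
    exact ⟨U, hV₁.trans hVU, hU₂⟩

theorem exists_terminalSet {X : Set 𝒜} (hX : X.Finite) :
    ∃ Z, TerminalSet A σ Z ∧ MovesTo A σ X Z := by
  induction X using hA.wellFounded_moveTo.induction with
  | _ X ih =>
    by_cases hT : TerminalSet A σ X
    · exact ⟨X, hT, .refl⟩
    · simp only [TerminalSet, not_forall] at hT
      obtain ⟨Y, hm, hne⟩ := hT
      obtain ⟨Z, hZ, hYZ⟩ := ih Y ⟨hX, hm, Ne.symm hne⟩ (hA.finite_of_moveTo hX hm)
      exact ⟨Z, hZ, hYZ.head hm⟩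

theorem normalForm_spec {X : Set 𝒜} (hX : X.Finite) :
    TerminalSet A σ (normalForm A σ X) ∧ MovesTo A σ X (normalForm A σ X) := by
  have h := hA.exists_terminalSet hX
  rw [normalForm, dif_pos h]
  exact h.choose_spec

theorem eq_normalForm {X Z : Set 𝒜} (hX : X.Finite) (hZ : TerminalSet A σ Z)
    (h : MovesTo A σ X Z) : Z = normalForm A σ X := by
  obtain ⟨hT, hm⟩ := hA.normalForm_spec hX
  obtain ⟨W, h₁, h₂⟩ := hA.joinable hX h hm
  rw [← hZ.eq_of_movesTo h₁, ← hT.eq_of_movesTo h₂]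

theorem normalForm_eq_of_movesTo {X Y : Set 𝒜} (hX : X.Finite) (h : MovesTo A σ X Y) :
    normalForm A σ X = normalForm A σ Y := by
  obtain ⟨hT, hm⟩ := hA.normalForm_spec (hA.finite_of_movesTo hX h)
  exact (hA.eq_normalForm hX hT (h.trans hm)).symm

theorem normalForm_eq_of_joinable {X Y : Set 𝒜} (hX : X.Finite) (hY : Y.Finite)
    (h : Joinable A σ X Y) : normalForm A σ X = normalForm A σ Y := by
  obtain ⟨Z, h₁, h₂⟩ := h
  rw [hA.normalForm_eq_of_movesTo hX h₁, hA.normalForm_eq_of_movesTo hY h₂]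

theorem normalForm_eq_self {X : Set 𝒜} (hX : X.Finite) (hT : TerminalSet A σ X) :
    normalForm A σ X = X :=
  (hA.eq_normalForm hX hT .refl).symm

theorem terminalSet_iff {X : Set 𝒜} : TerminalSet A σ X ↔ ∀ x ∈ X, TerminalSet A σ {x} := by
  refine ⟨fun h x hx => terminalSet_singleton.2 fun α hα => hA.maxElems_eq α x hα ?_, ?_⟩
  · have : x ∈ (X \ {x}) ∪ MaxElems (σ α x) := by rwa [h _ ⟨α, x, hx, hα, rfl⟩]
    simpa using this
  · rintro h _ ⟨α, x, hx, hα, rfl⟩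
    rw [terminalSet_singleton.1 (h x hx) α hα, Set.sdiff_union_self, Set.union_eq_left]
    simpa using hx

theorem normalForm_union_of_movesTo {X Y W : Set 𝒜} (hX : X.Finite) (hW : W.Finite)
    (h : MovesTo A σ X Y) : normalForm A σ (X ∪ W) = normalForm A σ (Y ∪ W) := by
  induction h with
  | refl => rfl
  | @tail Y Z hXY hYZ ih =>
    rw [ih]
    have hY := hA.finite_of_movesTo hX hXY
    have hZ := hA.finite_of_moveTo hY hYZ
    obtain ⟨α, x, hx, hα, rfl⟩ := hYZ
    set M := MaxElems (σ α x)
    have hmove : MoveTo A σ (Y ∪ W) ((Y ∪ W) \ {x} ∪ M) := ⟨α, x, Or.inl hx, hα, rfl⟩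
    rw [hA.normalForm_eq_of_movesTo (hY.union hW) (.single hmove)]
    by_cases hxW : x ∈ W
    · have hmove' : MoveTo A σ (Y \ {x} ∪ M ∪ W) ((Y \ {x} ∪ M ∪ W) \ {x} ∪ M) :=
        ⟨α, x, Or.inr hxW, hα, rfl⟩
      rw [hA.normalForm_eq_of_movesTo (hZ.union hW) (.single hmove')]
      congr 1
      ext a
      simp only [Set.mem_union, Set.mem_sdiff, Set.mem_singleton_iff]
      tauto
    · congr 1
      ext a
      have : a ∈ W → a ≠ x := fun h he => hxW (he ▸ h)
      simp only [Set.mem_union, Set.mem_sdiff, Set.mem_singleton_iff]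
      tauto

theorem normalForm_union {X W : Set 𝒜} (hX : X.Finite) (hW : W.Finite) :
    normalForm A σ (X ∪ W) = normalForm A σ X ∪ normalForm A σ W := by
  obtain ⟨hTX, hmX⟩ := hA.normalForm_spec hX
  obtain ⟨hTW, hmW⟩ := hA.normalForm_spec hW
  have hfX := hA.finite_of_movesTo hX hmX
  have hfW := hA.finite_of_movesTo hW hmW
  rw [hA.normalForm_union_of_movesTo hX hW hmX, Set.union_comm,
    hA.normalForm_union_of_movesTo hW hfX hmW, Set.union_comm]
  refine hA.normalForm_eq_self (hfX.union hfW) (hA.terminalSet_iff.2 ?_)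
  rintro x (hx | hx)
  · exact hA.terminalSet_iff.1 hTX x hx
  · exact hA.terminalSet_iff.1 hTW x hx

theorem mem_normalForm {X : Set 𝒜} (hX : X.Finite) {y : 𝒜} :
    y ∈ normalForm A σ X ↔ ∃ x ∈ X, y ∈ normalForm A σ {x} := by
  induction X, hX using Set.Finite.induction_on with
  | empty =>
    rw [hA.normalForm_eq_self Set.finite_empty (hA.terminalSet_iff.2 (by simp))]
    simp
  | @insert a s _ hs ih =>
    rw [Set.insert_eq, hA.normalForm_union (Set.finite_singleton a) hs, Set.mem_union, ih]
    simp

theorem wellFounded_mem_maxElems :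
    WellFounded fun y x : 𝒜 => ∃ α, x ∈ A α ∧ y ∈ MaxElems (σ α x) ∧ x ∉ MaxElems (σ α x) := by
  refine wellFounded_iff_isEmpty_descending_chain.2 ⟨?_⟩
  rintro ⟨x, hx⟩
  choose α hα hmem hnot using hx
  let f : ℕ → Set 𝒜 := fun k =>
    Nat.rec {x 0} (fun k X => X \ {x k} ∪ MaxElems (σ (α k) (x k))) k
  have hxf : ∀ k, x k ∈ f k := fun k => by
    cases k with
    | zero => exact rfl
    | succ k => exact Or.inr (hmem k)
  have hmove : ∀ k, MoveTo A σ (f k) (f (k + 1)) := fun k => ⟨α k, x k, hxf k, hα k, rfl⟩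
  refine hA.terminating ⟨f, fun k => ?_, fun k => ⟨hmove k, fun he => ?_⟩⟩
  · induction k with
    | zero => exact Set.finite_singleton _
    | succ k ih => exact hA.finite_of_moveTo ih (hmove k)
  · have h : x k ∈ f (k + 1) := he ▸ hxf k
    rcases h with h | h
    · exact h.2 rfl
    · exact hnot k h

end IsConvergentSystem

end Rewriting

section Canonical

variable {d n : ℕ} {𝒜 : Type*} [PartialOrder 𝒜] {p : 𝒜 → Fin n → Set (Fin d → ℝ)}

variable (p) in
/-- `X` is an `𝒜`-complex subdividing the tuple `p x`. -/
structure Subdivides (X : Set 𝒜) (x : 𝒜) : Prop where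
  isAComplex : IsAComplex p X
  suppOf_eq : suppOf p X = minkSum (p x)
  nsuppOf_eq : nsuppOf p X = p x

theorem Set.Finite.exists_le_mem_maxElems {X : Set 𝒜} (hX : X.Finite) {z : 𝒜} (hz : z ∈ X) :
    ∃ m ∈ MaxElems X, z ≤ m := by
  obtain ⟨m, hzm, hm⟩ := hX.exists_le_maximal hz
  exact ⟨m, ⟨hm.1, fun y hy hmy => hm.eq_of_le hy hmy⟩, hzm⟩

namespace IsPerfectPoset

variable (hp : IsPerfectPoset p)
include hp

theorem subdivides_Iic (x : 𝒜) : Subdivides p {y | y ≤ x} x where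
  isAComplex := hp.isAComplex_Iic x
  suppOf_eq := Set.Subset.antisymm (Set.iUnion₂_subset fun _ h => hp.minkSum_subset h)
    fun _ hq => mem_suppOf.2 ⟨x, le_refl x, hq⟩
  nsuppOf_eq := funext fun k => Set.Subset.antisymm (Set.iUnion₂_subset fun _ h => hp.subset h k)
    fun _ hq => mem_nsuppOf.2 ⟨x, le_refl x, hq⟩

theorem subdivides_biUnion {X : Set 𝒜} {x : 𝒜} (hX : Subdivides p X x) {T : 𝒜 → Set 𝒜}
    (hT : ∀ m ∈ X, Subdivides p (T m) m) (hmono : ∀ m ∈ X, ∀ z ≤ m, T z ⊆ T m) :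
    Subdivides p (⋃ m ∈ X, T m) x where
  isAComplex := by
    refine hp.isAComplex_of_isLowerSet
      (hX.isAComplex.finite.biUnion fun m hm => (hT m hm).isAComplex.finite)
      (isLowerSet_iUnion₂ fun m hm => hp.isLowerSet (hT m hm).isAComplex)
      fun u hu v hv q hqu hqv => ?_
    obtain ⟨a, ha, hua⟩ := Set.mem_iUnion₂.1 hu
    obtain ⟨b, hb, hvb⟩ := Set.mem_iUnion₂.1 hv
    have hqa : q ∈ minkSum (p a) := (hT a ha).suppOf_eq ▸
      mem_suppOf.2 ⟨u, hua, intrinsicInterior_subset hqu⟩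
    have hqb : q ∈ minkSum (p b) := (hT b hb).suppOf_eq ▸
      mem_suppOf.2 ⟨v, hvb, intrinsicInterior_subset hqv⟩
    obtain ⟨w, hw, hqw, hle⟩ := hp.exists_carrier hX.isAComplex (mem_suppOf.2 ⟨a, ha, hqa⟩)
    have hqT : q ∈ suppOf p (T w) := (hT w hw).suppOf_eq ▸ intrinsicInterior_subset hqw
    obtain ⟨c, hc, hqc, -⟩ := hp.exists_carrier (hT w hw).isAComplex hqT
    rw [(hT a ha).isAComplex.eq_of_mem_intrinsicInterior hua
        (hmono a ha w (hle a ha hqa) hc) hqu hqc,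
      (hT b hb).isAComplex.eq_of_mem_intrinsicInterior hvb
        (hmono b hb w (hle b hb hqb) hc) hqv hqc]
  suppOf_eq := by
    rw [← hX.suppOf_eq, suppOf, Set.biUnion_iUnion]
    simp only [Set.biUnion_iUnion]
    exact Set.iUnion₂_congr fun m hm => (hT m hm).suppOf_eq
  nsuppOf_eq := by
    rw [← hX.nsuppOf_eq]
    funext k
    simp only [nsuppOf, Set.biUnion_iUnion]
    exact Set.iUnion₂_congr fun m hm => congrFun (hT m hm).nsuppOf_eq k

theorem le_of_mem_subdivision {X : Set 𝒜} {x : 𝒜} (hX : Subdivides p X x) (hx : x ∈ X) {z : 𝒜}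
    (hz : z ∈ X) : z ≤ x := by
  obtain ⟨q, hq⟩ := hp.intrinsicInterior_nonempty z
  have hqX : q ∈ suppOf p X := mem_suppOf.2 ⟨z, hz, intrinsicInterior_subset hq⟩
  obtain ⟨u, hu, hqu, hle⟩ := hp.exists_carrier hX.isAComplex hqX
  rw [hX.isAComplex.eq_of_mem_intrinsicInterior hz hu hq hqu]
  exact hle x hx (hX.suppOf_eq ▸ hqX)

theorem maxElems_eq_singleton {X : Set 𝒜} {x : 𝒜} (hX : Subdivides p X x) (hx : x ∈ X) :
    MaxElems X = {x} := by
  ext z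
  refine ⟨fun hz => hz.2 x hx (hp.le_of_mem_subdivision hX hx hz.1), ?_⟩
  rintro rfl
  exact ⟨hx, fun y hy h => h.antisymm (hp.le_of_mem_subdivision hX hx hy)⟩

variable {ι : Type*} {A : ι → Set 𝒜} {σ : ι → 𝒜 → Set 𝒜}

theorem subdivides_downClosure_normalForm (hA : IsConvergentSystem A σ)
    (hσ : ∀ α, ∀ x ∈ A α, Subdivides p (σ α x) x)
    (hfc1 : ∀ α, ∀ x ∈ A α, ∀ y : 𝒜, y ≤ x → ∀ Y : Set 𝒜, SubdLE p Y (σ α x) →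
      nsuppOf p Y = p y → Joinable A σ (MaxElems Y) {y})
    (hfc2 : ∀ x y : 𝒜, y ≤ x → TerminalSet A σ {x} → TerminalSet A σ {y}) (x : 𝒜) :
    ∀ y ≤ x, Subdivides p {u | ∃ w ∈ normalForm A σ {y}, u ≤ w} y ∧
      ∀ z ≤ y, {u | ∃ w ∈ normalForm A σ {z}, u ≤ w} ⊆
        {u | ∃ w ∈ normalForm A σ {y}, u ≤ w} := by
  set T : 𝒜 → Set 𝒜 := fun y => {u | ∃ w ∈ normalForm A σ {y}, u ≤ w} with hTdef
  induction x using hA.wellFounded_mem_maxElems.induction with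
  | _ x ih =>
    by_cases hx : TerminalSet A σ {x}
    · have hT : ∀ y ≤ x, T y = {z | z ≤ y} := fun y hy => by
        simp [hTdef, hA.normalForm_eq_self (Set.finite_singleton y) (hfc2 x y hy hx)]
      intro y hy
      refine ⟨?_, fun z hz => ?_⟩
      · change Subdivides p (T y) y
        rw [hT y hy]
        exact hp.subdivides_Iic y
      · change T z ⊆ T y
        rw [hT y hy, hT z (hz.trans hy)]
        exact fun u hu => le_trans hu hz
    · simp only [terminalSet_singleton, not_forall] at hx
      obtain ⟨α, hα, hne⟩ := hx
      have hxM : x ∉ MaxElems (σ α x) := fun h => hne (hA.maxElems_eq α x hα h)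
      have hX := hσ α x hα
      have hgood : ∀ m ∈ σ α x, Subdivides p (T m) m ∧ ∀ z ≤ m, T z ⊆ T m := fun m hm => by
        obtain ⟨m', hm', hle⟩ := hX.isAComplex.finite.exists_le_mem_maxElems hm
        exact ih m' ⟨α, hα, hm', hxM⟩ m hle
      let R : 𝒜 → Set 𝒜 := fun y => {z | z ∈ σ α x ∧ minkSum (p z) ⊆ minkSum (p y)}
      have hR : ∀ y ≤ x, Subdivides p (R y) y := fun y hy => by
        obtain ⟨h₁, h₂, h₃⟩ := hp.restriction hX.isAComplex hy hX.suppOf_eq fun z hz j t ht =>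
          hX.nsuppOf_eq ▸ mem_nsuppOf.2 ⟨z, hz, ht⟩
        exact ⟨h₁, h₂, h₃⟩
      have hT : ∀ y ≤ x, T y = ⋃ m ∈ R y, T m := fun y hy => by
        have hfin := (hR y hy).isAComplex.finite
        have hfin' : (MaxElems (R y)).Finite := hfin.subset fun _ h => h.1
        have hNF := hA.normalForm_eq_of_joinable hfin' (Set.finite_singleton y)
          (hfc1 α x hα y hy (R y) ⟨fun _ h => h.1, (hR y hy).isAComplex, by
            rw [(hR y hy).suppOf_eq, hX.suppOf_eq]
            exact (hp.npFace y x hy).isFaceOf⟩ (hR y hy).nsuppOf_eq)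
        ext u
        rw [Set.mem_iUnion₂]
        constructor
        · rintro ⟨w, hw, huw⟩
          rw [← hNF, hA.mem_normalForm hfin'] at hw
          obtain ⟨m, hm, hw⟩ := hw
          exact ⟨m, hm.1, w, hw, huw⟩
        · rintro ⟨m, hm, hu⟩
          obtain ⟨m', hm', hle⟩ := hfin.exists_le_mem_maxElems hm
          obtain ⟨w, hw, huw⟩ := (hgood m' hm'.1.1).2 m hle hu
          refine ⟨w, ?_, huw⟩
          rw [← hNF, hA.mem_normalForm hfin']
          exact ⟨m', hm', hw⟩
      intro y hy
      refine ⟨?_, fun z hz => ?_⟩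
      · change Subdivides p (T y) y
        rw [hT y hy]
        exact hp.subdivides_biUnion (hR y hy) (fun m hm => (hgood m hm.1).1)
          fun m hm => (hgood m hm.1).2
      · change T z ⊆ T y
        rw [hT y hy, hT z (hz.trans hy)]
        exact Set.biUnion_subset_biUnion_left fun m hm =>
          ⟨hm.1, hm.2.trans (hp.minkSum_subset hz)⟩

end IsPerfectPoset

end Canonical

theorem statement4 (d n : ℕ) (hn : 0 < n) {𝒜 : Type*} [PartialOrder 𝒜] {ι : Type*}
    -- `(𝒜, p)` is a perfect `n𝒫`-poset:
    (p : 𝒜 → Fin n → Set (Fin d → ℝ))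
    (hpoly : ∀ x i, IsPolytope (p x i))
    (hmono : ∀ x y : 𝒜, x ≤ y → NPFace (p x) (p y))
    (hperfect : ∀ x : 𝒜, IsAComplex p {y | y ≤ x})
    -- `{σ_α : 𝒜_α → Subd(𝒜)}` is a family of subdivisions over `n𝒫`:
    (A : ι → Set 𝒜) (σ : ι → 𝒜 → Set 𝒜)
    (hσ : ∀ α, ∀ x ∈ A α, IsASubdivision p (σ α x) ∧ nsuppOf p (σ α x) = p x)
    -- locally confluent:
    (hconf : ∀ X : Set 𝒜, X.Finite → ∀ Y₁ Y₂, MoveTo A σ X Y₁ → MoveTo A σ X Y₂ →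
      Joinable A σ Y₁ Y₂)
    -- facially compatible:
    (hfc1 : ∀ α, ∀ x ∈ A α, ∀ y : 𝒜, y ≤ x → ∀ Y : Set 𝒜, SubdLE p Y (σ α x) →
      nsuppOf p Y = p y → Joinable A σ (MaxElems Y) {y})
    (hfc2 : ∀ x y : 𝒜, y ≤ x → TerminalSet A σ {x} → TerminalSet A σ {y})
    -- terminating:
    (hterm : ¬ ∃ f : ℕ → Set 𝒜, (∀ k, (f k).Finite) ∧
      ∀ k, MoveTo A σ (f k) (f (k + 1)) ∧ f k ≠ f (k + 1)) :
    -- conclusion: a unique terminal set `S x` with `{x} →* S x`, whose downward closure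
    -- `Σ(x) = ⟨S x⟩` is an `𝒜`-subdivision with `n`-support `p x`, and `x ↦ Σ(x)` is a
    -- canonical (i.e. monotone) subdivision over `n𝒫`.
    ∃ S : 𝒜 → Set 𝒜,
      (∀ x, (S x).Finite ∧ TerminalSet A σ (S x) ∧ MovesTo A σ {x} (S x)) ∧
      (∀ x, ∀ Z : Set 𝒜, TerminalSet A σ Z → MovesTo A σ {x} Z → Z = S x) ∧
      (∀ x, IsASubdivision p {y | ∃ z ∈ S x, y ≤ z} ∧
        nsuppOf p {y | ∃ z ∈ S x, y ≤ z} = p x) ∧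
      (∀ x y : 𝒜, y ≤ x →
        SubdLE p {z | ∃ w ∈ S y, z ≤ w} {z | ∃ w ∈ S x, z ≤ w}) := by
  have hp : IsPerfectPoset p := ⟨hpoly, hmono, hperfect⟩
  have hσ' : ∀ α, ∀ x ∈ A α, Subdivides p (σ α x) x := fun α x hx =>
    ⟨(hσ α x hx).1.1, hp.suppOf_eq_minkSum (hσ α x hx).1 (hpoly x) (hσ α x hx).2, (hσ α x hx).2⟩
  have hA : IsConvergentSystem A σ :=
    ⟨fun α x hx => (hσ α x hx).1.1.finite,
      fun α x hx h => hp.maxElems_eq_singleton (hσ' α x hx) h.1, hconf, hterm⟩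
  have key := hp.subdivides_downClosure_normalForm hA hσ' hfc1 hfc2
  have hsub := fun x => (key x x le_rfl).1
  refine ⟨fun x => normalForm A σ {x}, fun x => ?_, fun x Z hZ hm => ?_, fun x => ?_,
    fun x y hyx => ?_⟩
  · obtain ⟨hT, hm⟩ := hA.normalForm_spec (Set.finite_singleton x)
    exact ⟨hA.finite_of_movesTo (Set.finite_singleton x) hm, hT, hm⟩
  · exact hA.eq_normalForm (Set.finite_singleton x) hZ hm
  · exact ⟨⟨(hsub x).isAComplex, (hsub x).suppOf_eq ▸ hp.isPolytope_minkSum x⟩,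
      (hsub x).nsuppOf_eq⟩
  · refine ⟨(key x x le_rfl).2 y hyx, (hsub y).isAComplex, ?_⟩
    rw [(hsub y).suppOf_eq, (hsub x).suppOf_eq]
    exact (hmono y x hyx).isFaceOf
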